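/- Let J₀, J₁ be the Bessel functions of the first kind of orders 0 and 1 (defined by Jₙ(x) = (1/π)∫₀^π cos(nθ − x sin θ) dθ), let H₀, H₁ be the Struve functions of orders 0 and 1, and let D(x) = H₀(x)·J₁(x) − H₁(x)·J₀(x). Then for every real x ≥ 0, ∫₀^x t²·J₀(t) dt = x²·J₁(x) − (π x/2)·D(x). -/

import Mathlib

open Real MeasureTheory

noncomputable def J0 (x : ℝ) : ℝ := (1 / π) * ∫ θ in (0:ℝ)..π, Real.cos (x * Real.sin θ)

noncomputable def J1 (x : ℝ) : ℝ := (1 / π) * ∫ θ in (0:ℝ)..π, Real.cos (θ - x * Real.sin θ)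

noncomputable def H0 (x : ℝ) : ℝ :=
  (2 / π) * ∫ θ in (0:ℝ)..(π / 2), Real.sin (x * Real.cos θ)

noncomputable def H1 (x : ℝ) : ℝ :=
  (2 * x / π) * ∫ θ in (0:ℝ)..(π / 2), Real.sin (x * Real.cos θ) * Real.sin θ ^ 2

noncomputable def D (x : ℝ) : ℝ := H0 x * J1 x - H1 x * J0 x

/-- Differentiation under the integral sign for a sine transform with continuous data. -/
theorem hasDerivAt_integral_mul_sin {w u : ℝ → ℝ} (hw : Continuous w) (hu : Continuous u)
    (a b x : ℝ) :
    HasDerivAt (fun x => ∫ θ in a..b, w θ * Real.sin (x * u θ))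
      (∫ θ in a..b, w θ * (Real.cos (x * u θ) * u θ)) x := by
  refine (intervalIntegral.hasDerivAt_integral_of_dominated_loc_of_deriv_le
    (F := fun x θ => w θ * Real.sin (x * u θ))
    (F' := fun x θ => w θ * (Real.cos (x * u θ) * u θ))
    (bound := fun θ => |w θ| * |u θ|) Filter.univ_mem
    (Filter.Eventually.of_forall fun y => (by fun_prop : Continuous _).aestronglyMeasurable)
    ((by fun_prop : Continuous _).intervalIntegrable _ _)
    (by fun_prop : Continuous _).aestronglyMeasurable
    (Filter.Eventually.of_forall fun θ _ y _ => ?_)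
    ((by fun_prop : Continuous _).intervalIntegrable _ _)
    (Filter.Eventually.of_forall fun θ _ y _ => ?_)).2
  · rw [Real.norm_eq_abs, abs_mul, abs_mul]
    gcongr
    exact mul_le_of_le_one_left (abs_nonneg _) (Real.abs_cos_le_one _)
  · simpa using (((hasDerivAt_id y).mul_const (u θ)).sin).const_mul (w θ)

/-- Differentiation under the integral sign for a cosine transform with continuous data. -/
theorem hasDerivAt_integral_cos {u : ℝ → ℝ} (hu : Continuous u) (a b x : ℝ) :
    HasDerivAt (fun x => ∫ θ in a..b, Real.cos (x * u θ))
      (∫ θ in a..b, -Real.sin (x * u θ) * u θ) x := by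
  refine (intervalIntegral.hasDerivAt_integral_of_dominated_loc_of_deriv_le
    (F := fun x θ => Real.cos (x * u θ))
    (F' := fun x θ => -Real.sin (x * u θ) * u θ)
    (bound := fun θ => |u θ|) Filter.univ_mem
    (Filter.Eventually.of_forall fun y => (by fun_prop : Continuous _).aestronglyMeasurable)
    ((by fun_prop : Continuous _).intervalIntegrable _ _)
    (by fun_prop : Continuous _).aestronglyMeasurable
    (Filter.Eventually.of_forall fun θ _ y _ => ?_)
    ((by fun_prop : Continuous _).intervalIntegrable _ _)
    (Filter.Eventually.of_forall fun θ _ y _ => ?_)).2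
  · rw [Real.norm_eq_abs, abs_mul, abs_neg]
    exact mul_le_of_le_one_left (abs_nonneg _) (Real.abs_sin_le_one _)
  · simpa using ((hasDerivAt_id y).mul_const (u θ)).cos

theorem integral_cos_mul_cos_mul_sin (x : ℝ) :
    ∫ θ in (0:ℝ)..π, Real.cos θ * Real.cos (x * Real.sin θ) = 0 := by
  have h := intervalIntegral.integral_comp_sub_left (a := 0) (b := π)
    (fun θ => Real.cos θ * Real.cos (x * Real.sin θ)) π
  simp only [Real.cos_pi_sub, Real.sin_pi_sub, sub_self, sub_zero, neg_mul,
    intervalIntegral.integral_neg] at h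
  linarith

theorem J1_eq (x : ℝ) :
    J1 x = (1 / π) * ∫ θ in (0:ℝ)..π, Real.sin θ * Real.sin (x * Real.sin θ) := by
  simp only [J1, Real.cos_sub]
  rw [intervalIntegral.integral_add ((by fun_prop : Continuous _).intervalIntegrable _ _)
    ((by fun_prop : Continuous _).intervalIntegrable _ _), integral_cos_mul_cos_mul_sin, zero_add]

theorem hasDerivAt_J0 (x : ℝ) : HasDerivAt J0 (-J1 x) x := by
  refine ((hasDerivAt_integral_cos Real.continuous_sin 0 π x).const_mul (1 / π)).congr_deriv ?_
  rw [J1_eq, ← mul_neg, ← intervalIntegral.integral_neg]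
  congr 2 with θ
  ring

theorem hasDerivAt_mul_J1 (x : ℝ) : HasDerivAt (fun x => x * J1 x) (x * J0 x) x := by
  have hJ : HasDerivAt J1 _ x := (funext J1_eq) ▸
    (hasDerivAt_integral_mul_sin Real.continuous_sin Real.continuous_sin 0 π x).const_mul (1 / π)
  refine ((hasDerivAt_id x).mul hJ).congr_deriv ?_
  have key : ∫ θ in (0:ℝ)..π, (Real.sin θ * Real.sin (x * Real.sin θ)
      + x * (Real.sin θ * (Real.cos (x * Real.sin θ) * Real.sin θ))
      - x * Real.cos (x * Real.sin θ)) = 0 := by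
    rw [intervalIntegral.integral_eq_sub_of_hasDerivAt
      (f := fun θ => -Real.cos θ * Real.sin (x * Real.sin θ)) (fun θ _ => ?_)
      ((by fun_prop : Continuous _).intervalIntegrable _ _)]
    · simp
    · refine ((Real.hasDerivAt_cos θ).neg.mul
        ((Real.hasDerivAt_sin θ).const_mul x).sin).congr_deriv ?_
      simp only [Pi.neg_apply]
      linear_combination (-x * Real.cos (x * Real.sin θ)) * Real.sin_sq_add_cos_sq θ
  rw [intervalIntegral.integral_sub ((by fun_prop : Continuous _).intervalIntegrable _ _)
    ((by fun_prop : Continuous _).intervalIntegrable _ _),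
    intervalIntegral.integral_add ((by fun_prop : Continuous _).intervalIntegrable _ _)
    ((by fun_prop : Continuous _).intervalIntegrable _ _),
    intervalIntegral.integral_const_mul, intervalIntegral.integral_const_mul] at key
  simp only [id, J1_eq, J0]
  linear_combination (1 / π) * key

theorem hasDerivAt_H0 (x : ℝ) : HasDerivAt H0 (2 / π - H1 x) x := by
  have h := (hasDerivAt_integral_mul_sin (continuous_const (y := (1:ℝ))) Real.continuous_cos
    0 (π / 2) x).const_mul (2 / π)
  simp only [one_mul] at h
  refine h.congr_deriv ?_
  have key : ∫ θ in (0:ℝ)..(π / 2), (Real.cos (x * Real.cos θ) * Real.cos θ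
      + x * (Real.sin (x * Real.cos θ) * Real.sin θ ^ 2)) = 1 := by
    rw [intervalIntegral.integral_eq_sub_of_hasDerivAt
      (f := fun θ => Real.sin θ * Real.cos (x * Real.cos θ)) (fun θ _ => ?_)
      ((by fun_prop : Continuous _).intervalIntegrable _ _)]
    · simp
    · refine ((Real.hasDerivAt_sin θ).mul
        ((Real.hasDerivAt_cos θ).const_mul x).cos).congr_deriv ?_
      ring
  rw [intervalIntegral.integral_add ((by fun_prop : Continuous _).intervalIntegrable _ _)
    ((by fun_prop : Continuous _).intervalIntegrable _ _),
    intervalIntegral.integral_const_mul] at key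
  simp only [H1]
  linear_combination (2 / π) * key

theorem hasDerivAt_mul_H1 (x : ℝ) : HasDerivAt (fun x => x * H1 x) (x * H0 x) x := by
  have h := ((hasDerivAt_id x).pow 2).mul ((hasDerivAt_integral_mul_sin
    (Real.continuous_sin.pow 2) Real.continuous_cos 0 (π / 2) x).const_mul (2 / π))
  have hfun : (fun x => x * H1 x) = id ^ 2 * fun x => 2 / π *
      ∫ θ in (0:ℝ)..(π / 2), Real.sin θ ^ 2 * Real.sin (x * Real.cos θ) := by
    ext y
    simp only [H1, Pi.mul_apply, Pi.pow_apply, id, mul_comm (Real.sin (y * _))]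
    ring
  rw [hfun]
  refine h.congr_deriv ?_
  have key : ∫ θ in (0:ℝ)..(π / 2), (2 * (Real.sin θ ^ 2 * Real.sin (x * Real.cos θ))
      + x * (Real.sin θ ^ 2 * (Real.cos (x * Real.cos θ) * Real.cos θ))
      - Real.sin (x * Real.cos θ)) = 0 := by
    rw [intervalIntegral.integral_eq_sub_of_hasDerivAt
      (f := fun θ => -(Real.sin θ * Real.cos θ * Real.sin (x * Real.cos θ))) (fun θ _ => ?_)
      ((by fun_prop : Continuous _).intervalIntegrable _ _)]
    · simp
    · refine (((Real.hasDerivAt_sin θ).mul (Real.hasDerivAt_cos θ)).mul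
        ((Real.hasDerivAt_cos θ).const_mul x).sin).neg.congr_deriv ?_
      simp only [Pi.mul_apply]
      linear_combination (-Real.sin (x * Real.cos θ)) * Real.sin_sq_add_cos_sq θ
  rw [intervalIntegral.integral_sub ((by fun_prop : Continuous _).intervalIntegrable _ _)
    ((by fun_prop : Continuous _).intervalIntegrable _ _),
    intervalIntegral.integral_add ((by fun_prop : Continuous _).intervalIntegrable _ _)
    ((by fun_prop : Continuous _).intervalIntegrable _ _),
    intervalIntegral.integral_const_mul, intervalIntegral.integral_const_mul] at key
  simp only [H0, id, Pi.pow_apply]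
  push_cast
  linear_combination (2 / π) * x * key

theorem hasDerivAt_mul_D (x : ℝ) : HasDerivAt (fun x => x * D x) (2 / π * (x * J1 x)) x := by
  have hfun : (fun x => x * D x) =
      H0 * (fun x => x * J1 x) - (fun x => x * H1 x) * J0 := by
    ext y
    simp only [D, Pi.sub_apply, Pi.mul_apply]
    ring
  rw [hfun]
  refine (((hasDerivAt_H0 x).mul (hasDerivAt_mul_J1 x)).sub
    ((hasDerivAt_mul_H1 x).mul (hasDerivAt_J0 x))).congr_deriv ?_
  ring

theorem hasDerivAt_sq_mul_J1_sub_mul_D (x : ℝ) :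
    HasDerivAt (fun x => x * (x * J1 x) - π / 2 * (x * D x)) (x ^ 2 * J0 x) x := by
  refine (((hasDerivAt_id x).mul (hasDerivAt_mul_J1 x)).sub
    ((hasDerivAt_mul_D x).const_mul (π / 2))).congr_deriv ?_
  have := Real.pi_ne_zero
  simp only [id]
  field_simp
  ring

theorem integral_sq_mul_J0 (x : ℝ) (hx : 0 ≤ x) :
    ∫ t in (0:ℝ)..x, t ^ 2 * J0 t = x ^ 2 * J1 x - (π * x / 2) * D x := by
  have hJ0 : Continuous J0 :=
    continuous_iff_continuousAt.2 fun t => (hasDerivAt_J0 t).continuousAt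
  rw [intervalIntegral.integral_eq_sub_of_hasDerivAt
    (fun t _ => hasDerivAt_sq_mul_J1_sub_mul_D t)
    ((by fun_prop : Continuous _).intervalIntegrable _ _)]
  ring
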